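/- For a natural number n ≥ 3 and a nonzero real number m, real numbers b and c satisfy the system (n−1)b + c = −1, (n−1)b² − c² = −1/m if and only if (m+n−2)/(m(n−1)) ≥ 0 and either b = (1/(n−2))(−1 + √((m+n−2)/(m(n−1)))) with c = −(1/(n−2))(−1 + √((m+n−2)(n−1)/m)), or b = (1/(n−2))(−1 − √((m+n−2)/(m(n−1)))) with c = −(1/(n−2))(−1 − √((m+n−2)(n−1)/m)). -/

import Mathlib

/-- Rescaling a square root by a nonnegative factor `k`. -/
theorem Real.sqrt_mul_div_eq_mul_sqrt {k : ℝ} (hk : 0 < k) (a m : ℝ) :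
    √(a * k / m) = k * √(a / (m * k)) := by
  have h : a * k / m = k ^ 2 * (a / (m * k)) := by
    field_simp
  rw [h, Real.sqrt_mul (sq_nonneg k), Real.sqrt_sq hk.le]

/-- Eliminating `c` with the linear equation and completing the square in `b`. -/
theorem system_iff_sq_eq {k m : ℝ} (hk : 1 < k) (hm : m ≠ 0) (b c : ℝ) :
    (k * b + c = -1 ∧ k * b ^ 2 - c ^ 2 = -1 / m) ↔
      (c = -1 - k * b ∧ ((k - 1) * b + 1) ^ 2 = (m + k - 1) / (m * k)) := by
  have hk0 : k ≠ 0 := by positivity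
  have hk1 : k - 1 ≠ 0 := (sub_pos.2 hk).ne'
  have hlin : k * b + c = -1 ↔ c = -1 - k * b := by
    constructor <;> intro h <;> linarith
  rw [hlin]
  refine and_congr_right fun hc => ?_
  subst hc
  have hkey : k * (((k - 1) * b + 1) ^ 2 - (m + k - 1) / (m * k)) =
      -(k - 1) * (k * b ^ 2 - (-1 - k * b) ^ 2 - -1 / m) := by
    field_simp
    ring
  rw [← sub_eq_zero, ← mul_right_inj' (neg_ne_zero.2 hk1), mul_zero, ← hkey,
    mul_eq_zero_iff_left hk0, sub_eq_zero]

/-- For `n ≥ 3` and `m ≠ 0`, the system `(n−1)b + c = −1`, `(n−1)b² − c² = −1/m` holds iff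
`(m+n−2)/(m(n−1)) ≥ 0` and `(b, c)` is one of the two explicit pairs
`b± = (1/(n−2))(−1 ± √((m+n−2)/(m(n−1))))`,
`c± = −(1/(n−2))(−1 ± √((m+n−2)(n−1)/m))`. -/
theorem system_iff_explicit_solutions (n : ℕ) (hn : 3 ≤ n) (m : ℝ) (hm : m ≠ 0) (b c : ℝ) :
    (((n : ℝ) - 1) * b + c = -1 ∧ ((n : ℝ) - 1) * b ^ 2 - c ^ 2 = -1 / m) ↔
    ((m + (n : ℝ) - 2) / (m * ((n : ℝ) - 1)) ≥ 0 ∧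
      ((b = (1 / ((n : ℝ) - 2)) * (-1 + Real.sqrt ((m + (n : ℝ) - 2) / (m * ((n : ℝ) - 1)))) ∧
        c = -(1 / ((n : ℝ) - 2)) * (-1 + Real.sqrt ((m + (n : ℝ) - 2) * ((n : ℝ) - 1) / m))) ∨
       (b = (1 / ((n : ℝ) - 2)) * (-1 - Real.sqrt ((m + (n : ℝ) - 2) / (m * ((n : ℝ) - 1)))) ∧
        c = -(1 / ((n : ℝ) - 2)) * (-1 - Real.sqrt ((m + (n : ℝ) - 2) * ((n : ℝ) - 1) / m))))) := by
  have hn' : (3 : ℝ) ≤ n := by exact_mod_cast hn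
  obtain ⟨k, hk⟩ : ∃ k : ℝ, k = (n : ℝ) - 1 := ⟨_, rfl⟩
  have hk1 : 1 < k := by linarith
  have hk0 : k - 1 ≠ 0 := (sub_pos.2 hk1).ne'
  rw [show (n : ℝ) - 2 = k - 1 by linarith, show m + (n : ℝ) - 2 = m + k - 1 by linarith, ← hk,
    system_iff_sq_eq hk1 hm, Real.sqrt_mul_div_eq_mul_sqrt (by linarith)]
  constructor
  · rintro ⟨rfl, hsq⟩
    have hD : 0 ≤ (m + k - 1) / (m * k) := hsq ▸ sq_nonneg _
    refine ⟨hD, ?_⟩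
    rw [← Real.sq_sqrt hD, sq_eq_sq_iff_eq_or_eq_neg] at hsq
    refine hsq.imp (fun h => ?_) (fun h => ?_)
    · rw [← h]
      constructor <;> field_simp <;> ring
    · rw [← neg_eq_iff_eq_neg.2 h]
      constructor <;> field_simp <;> ring
  · rintro ⟨hD, ⟨rfl, rfl⟩ | ⟨rfl, rfl⟩⟩
    all_goals
      refine ⟨by field_simp; ring, ?_⟩
      rw [← mul_assoc, mul_one_div_cancel hk0]
      refine Eq.trans ?_ (Real.sq_sqrt hD)
      ring
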